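/- arXiv:math/0401442 — 3 statements merged into one kernel-verified Lean document; each statement's English description precedes it below -/
import Mathlib

section
/- Let z₁, z₂, w ∈ ℂ satisfy |z₁|² + |z₂|² ≤ 1 and |w| ≤ 1. Then |(1 + z₁)z₁/2 + (1 − z₁)z₂w/2|² ≤ (1 + |z₁|²)/2 ≤ 1. Consequently the function f(z₁, z₂) = (1 + z₁)z₁/2 + (1 − z₁)z₂w/2 has modulus at most 1 on the closed unit ball of ℂ² and satisfies f(1, 0) = 1. -/
/-- For `|z₁|² + |z₂|² ≤ 1` and `|w| ≤ 1`, the function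
`f(z₁, z₂) = (1 + z₁)z₁/2 + (1 − z₁)z₂w/2` satisfies
`|f(z₁,z₂)|² ≤ (1 + |z₁|²)/2 ≤ 1`; consequently `|f| ≤ 1` on the closed unit ball
of `ℂ²`, and `f(1, 0) = 1`. -/
theorem stmt6 (z₁ z₂ w : ℂ) (h : ‖z₁‖ ^ 2 + ‖z₂‖ ^ 2 ≤ 1) (hw : ‖w‖ ≤ 1) :
    ‖(1 + z₁) * z₁ / 2 + (1 - z₁) * z₂ * w / 2‖ ^ 2 ≤ (1 + ‖z₁‖ ^ 2) / 2 ∧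
    (1 + ‖z₁‖ ^ 2) / 2 ≤ 1 ∧
    ‖(1 + z₁) * z₁ / 2 + (1 - z₁) * z₂ * w / 2‖ ≤ 1 ∧
    (1 + (1 : ℂ)) * 1 / 2 + (1 - (1 : ℂ)) * 0 * w / 2 = 1 := by
  have hpar : ‖1 + z₁‖ ^ 2 + ‖1 - z₁‖ ^ 2 = 2 * (1 + ‖z₁‖ ^ 2) := by
    have := parallelogram_law_with_norm ℝ (1 : ℂ) z₁
    rw [norm_one] at this
    linarith
  have htri : ‖(1 + z₁) * z₁ / 2 + (1 - z₁) * z₂ * w / 2‖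
      ≤ (‖1 + z₁‖ * ‖z₁‖ + ‖1 - z₁‖ * (‖z₂‖ * ‖w‖)) / 2 := by
    refine (norm_add_le _ _).trans_eq ?_
    simp only [norm_mul, norm_div, Complex.norm_ofNat]
    ring
  have hq : ‖z₁‖ ^ 2 + (‖z₂‖ * ‖w‖) ^ 2 ≤ 1 := by
    have : ‖z₂‖ * ‖w‖ ≤ ‖z₂‖ := mul_le_of_le_one_right (norm_nonneg _) hw
    have : (‖z₂‖ * ‖w‖) ^ 2 ≤ ‖z₂‖ ^ 2 := by gcongr
    linarith
  have hcs : (‖1 + z₁‖ * ‖z₁‖ + ‖1 - z₁‖ * (‖z₂‖ * ‖w‖)) ^ 2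
      ≤ 2 * (1 + ‖z₁‖ ^ 2) := by
    calc (‖1 + z₁‖ * ‖z₁‖ + ‖1 - z₁‖ * (‖z₂‖ * ‖w‖)) ^ 2
        ≤ (‖1 + z₁‖ ^ 2 + ‖1 - z₁‖ ^ 2) * (‖z₁‖ ^ 2 + (‖z₂‖ * ‖w‖) ^ 2) := by
          linarith [sq_nonneg (‖1 + z₁‖ * (‖z₂‖ * ‖w‖) - ‖1 - z₁‖ * ‖z₁‖)]
      _ ≤ ‖1 + z₁‖ ^ 2 + ‖1 - z₁‖ ^ 2 := mul_le_of_le_one_right (by positivity) hq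
      _ = 2 * (1 + ‖z₁‖ ^ 2) := hpar
  have hmain : ‖(1 + z₁) * z₁ / 2 + (1 - z₁) * z₂ * w / 2‖ ^ 2 ≤ (1 + ‖z₁‖ ^ 2) / 2 := by
    have := pow_le_pow_left₀ (norm_nonneg _) htri 2
    linarith
  have hone : (1 + ‖z₁‖ ^ 2) / 2 ≤ 1 := by linarith [sq_nonneg ‖z₂‖]
  refine ⟨hmain, hone, ?_, by norm_num⟩
  exact (sq_le_one_iff₀ (norm_nonneg _)).1 (hmain.trans hone)
end

section
/- Let H be a complex Hilbert space, n ≥ 1, A₁, …, Aₙ bounded linear operators on H, and λ₁, …, λₙ ∈ ℂ. Let 𝔄 denote the smallest norm-closed unital subalgebra of B(H) containing A₁, …, Aₙ and closed under adjoints (the unital C*-algebra generated by A₁, …, Aₙ). Then the following are equivalent: (i) there exists a unital algebra homomorphism Φ : 𝔄 → ℂ satisfying Φ(T*) = conj(Φ(T)) for all T ∈ 𝔄 and Φ(Aᵢ) = λᵢ for 1 ≤ i ≤ n; (ii) there exists a sequence of unit vectors x_k in H such that for each i, ‖Aᵢ x_k − λᵢ x_k‖ → 0 and ‖Aᵢ*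 x_k − conj(λᵢ) x_k‖ → 0 as k → ∞. -/
open ContinuousLinearMap Filter

section ApproximateEigenvectors

variable {H : Type*} [NormedAddCommGroup H] [InnerProductSpace ℂ H] {ι : Type*}

/-- The family `x` consists of approximate eigenvectors of `T` for `μ` along the filter `l`. -/
def IsApproxEigen (l : Filter ι) (x : ι → H) (T : H →L[ℂ] H) (μ : ℂ) : Prop :=
  Tendsto (fun k => T (x k) - μ • x k) l (nhds 0)

namespace IsApproxEigen

variable {l : Filter ι} {x : ι → H} {S T : H →L[ℂ] H} {μ ν : ℂ}

theorem iff_norm :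
    IsApproxEigen l x T μ ↔ Tendsto (fun k => ‖T (x k) - μ • x k‖) l (nhds 0) :=
  tendsto_zero_iff_norm_tendsto_zero

theorem algebraMap (c : ℂ) : IsApproxEigen l x (algebraMap ℂ (H →L[ℂ] H) c) c := by
  simp [IsApproxEigen, Algebra.algebraMap_eq_smul_one, tendsto_const_nhds]

theorem add (hS : IsApproxEigen l x S μ) (hT : IsApproxEigen l x T ν) :
    IsApproxEigen l x (S + T) (μ + ν) := by
  have h := Tendsto.add hS hT
  rw [add_zero] at h
  refine h.congr fun k => ?_
  simp only [add_apply, add_smul]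
  abel

theorem mul (hS : IsApproxEigen l x S μ) (hT : IsApproxEigen l x T ν) :
    IsApproxEigen l x (S * T) (μ * ν) := by
  have h := ((S.continuous.tendsto 0).comp hT).add (Tendsto.const_smul hS ν)
  rw [map_zero, smul_zero, add_zero] at h
  refine h.congr fun k => ?_
  simp only [Function.comp, map_sub, map_smul, mul_apply_eq_comp, smul_sub, smul_smul,
    mul_comm ν μ]
  abel

theorem tendsto_inner (hx : ∀ k, ‖x k‖ = 1) (hT : IsApproxEigen l x T μ) :
    Tendsto (fun k => inner ℂ (x k) (T (x k))) l (nhds μ) := by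
  rw [tendsto_iff_norm_sub_tendsto_zero]
  refine squeeze_zero (fun _ => norm_nonneg _) (fun k => ?_) (iff_norm.1 hT)
  have h : inner ℂ (x k) (T (x k)) - μ = inner ℂ (x k) (T (x k) - μ • x k) := by
    simp [inner_self_eq_norm_sq_to_K, hx]
  rw [h]
  exact (norm_inner_le_norm _ _).trans_eq (by rw [hx, one_mul])

theorem unique [l.NeBot] (hx : ∀ k, ‖x k‖ = 1) (hS : IsApproxEigen l x T μ)
    (hT : IsApproxEigen l x T ν) : μ = ν :=
  tendsto_nhds_unique (hS.tendsto_inner hx) (hT.tendsto_inner hx)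

theorem eq_conj [CompleteSpace H] [l.NeBot] (hx : ∀ k, ‖x k‖ = 1) (hS : IsApproxEigen l x T μ)
    (hT : IsApproxEigen l x (star T) ν) : ν = starRingEnd ℂ μ := by
  refine tendsto_nhds_unique (hT.tendsto_inner hx) ?_
  refine ((Complex.continuous_conj.tendsto μ).comp (hS.tendsto_inner hx)).congr fun k => ?_
  simp [star_eq_adjoint, adjoint_inner_right]

end IsApproxEigen

/-- The operators for which `x` is a family of approximate eigenvectors along `l`. -/
def approxEigenSubalgebra (l : Filter ι) (x : ι → H) : Subalgebra ℂ (H →L[ℂ] H) where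
  carrier := {T | ∃ μ, IsApproxEigen l x T μ}
  mul_mem' := fun ⟨_, h⟩ ⟨_, h'⟩ => ⟨_, h.mul h'⟩
  add_mem' := fun ⟨_, h⟩ ⟨_, h'⟩ => ⟨_, h.add h'⟩
  algebraMap_mem' c := ⟨c, .algebraMap c⟩

theorem isClosed_approxEigenSubalgebra (l : Ultrafilter ι) {x : ι → H} (hx : ∀ k, ‖x k‖ = 1) :
    IsClosed (approxEigenSubalgebra (l : Filter ι) x : Set (H →L[ℂ] H)) := by
  refine isClosed_of_closure_subset fun T hT => ?_
  obtain ⟨μ, -, hμ⟩ : ∃ μ ∈ Metric.closedBall (0 : ℂ) ‖T‖,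
      Tendsto (fun k => inner ℂ (x k) (T (x k))) l (nhds μ) := by
    refine (isCompact_closedBall (0 : ℂ) ‖T‖).ultrafilter_le_nhds
      (l.map fun k => inner ℂ (x k) (T (x k))) ?_
    refine tendsto_principal.2 (Eventually.of_forall fun k => ?_)
    have h := (norm_inner_le_norm (𝕜 := ℂ) (x k) (T (x k))).trans
      (mul_le_mul_of_nonneg_left (T.le_opNorm (x k)) (norm_nonneg _))
    simpa [hx] using h
  refine ⟨μ, IsApproxEigen.iff_norm.2 ?_⟩
  rw [Metric.tendsto_nhds]
  intro ε hε
  obtain ⟨S, ⟨ν, hS⟩, hTS⟩ := Metric.mem_closure_iff.1 hT (ε / 5) (by positivity)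
  rw [dist_eq_norm] at hTS
  filter_upwards [Metric.tendsto_nhds.1 (IsApproxEigen.iff_norm.1 hS) (ε / 5) (by positivity),
    Metric.tendsto_nhds.1 (hS.tendsto_inner hx) (ε / 5) (by positivity),
    Metric.tendsto_nhds.1 hμ (ε / 5) (by positivity)] with k h₁ h₂ h₃
  rw [dist_zero_right, norm_norm] at h₁ ⊢
  rw [dist_eq_norm] at h₂ h₃
  have h₄ : ‖(T - S) (x k)‖ ≤ ‖T - S‖ := by simpa [hx] using (T - S).le_opNorm (x k)
  have h₅ : ‖inner ℂ (x k) ((T - S) (x k))‖ ≤ ‖T - S‖ :=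
    (norm_inner_le_norm (𝕜 := ℂ) _ _).trans (by simpa [hx] using h₄)
  have h₆ : ‖ν - μ‖ ≤ ‖inner ℂ (x k) (S (x k)) - ν‖ + ‖inner ℂ (x k) ((T - S) (x k))‖ +
      ‖inner ℂ (x k) (T (x k)) - μ‖ := by
    have h : ν - μ = -(inner ℂ (x k) (S (x k)) - ν) + -inner ℂ (x k) ((T - S) (x k)) +
        (inner ℂ (x k) (T (x k)) - μ) := by
      simp only [sub_apply, inner_sub_right]
      ring
    rw [h]
    exact norm_add₃_le.trans (by simp only [norm_neg, le_refl])
  have h₇ : T (x k) - μ • x k = (T - S) (x k) + (S (x k) - ν • x k) + (ν - μ) • x k := by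
    simp only [sub_apply, sub_smul]
    abel
  have h₈ : ‖(ν - μ) • x k‖ = ‖ν - μ‖ := by rw [norm_smul, hx, mul_one]
  rw [h₇]
  refine norm_add₃_le.trans_lt ?_
  linarith

end ApproximateEigenvectors

section Characters

variable {H : Type*} [NormedAddCommGroup H] [InnerProductSpace ℂ H] [CompleteSpace H]

theorem exists_character_of_isApproxEigen {ι : Type*} (l : Ultrafilter ι) {x : ι → H}
    (hx : ∀ k, ‖x k‖ = 1) (B : StarSubalgebra ℂ (H →L[ℂ] H))
    (hB : ∀ T ∈ B, ∃ μ, IsApproxEigen (l : Filter ι) x T μ) :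
    ∃ Φ : B →ₐ[ℂ] ℂ, (∀ T, Φ (star T) = starRingEnd ℂ (Φ T)) ∧
      ∀ T : B, IsApproxEigen (l : Filter ι) x T (Φ T) := by
  choose f hf using fun T : B => hB T T.2
  refine ⟨AlgHom.mk' (RingHom.mk' ⟨⟨f, ?_⟩, ?_⟩ ?_) ?_, ?_, hf⟩
  · exact (hf 1).unique hx (by simpa using IsApproxEigen.algebraMap (l := (l : Filter ι)) (x := x) 1)
  · exact fun S T => (hf (S * T)).unique hx ((hf S).mul (hf T))
  · exact fun S T => (hf (S + T)).unique hx ((hf S).add (hf T))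
  · intro c T
    refine (hf (c • T)).unique hx ?_
    have h := (IsApproxEigen.algebraMap c).mul (hf T)
    rwa [← Algebra.smul_def] at h
  · exact fun T => (hf T).eq_conj hx (hf (star T))

theorem isUnit_sum_of_bounded_below {ι : Type*} [Fintype ι] (T : ι → H →L[ℂ] H) {c : ℝ}
    (hc : 0 < c) (h : ∀ x, c * ‖x‖ ^ 2 ≤ ∑ i, ‖T i x‖ ^ 2) :
    IsUnit (∑ i, star (T i) * T i) := by
  refine isUnit_of_forall_le_norm_inner_map _ (c := ⟨c, hc.le⟩) hc fun x => ?_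
  have h' : inner ℂ ((∑ i, star (T i) * T i) x) x = ((∑ i, ‖T i x‖ ^ 2 : ℝ) : ℂ) := by
    simp [sum_apply, star_eq_adjoint, adjoint_inner_left, inner_self_eq_norm_sq_to_K]
  rw [h', Complex.norm_real, Real.norm_of_nonneg (by positivity), mul_comm]
  exact h x

theorem exists_unit_vector_of_not_isUnit {ι : Type*} [Fintype ι] (T : ι → H →L[ℂ] H)
    (hT : ¬ IsUnit (∑ i, star (T i) * T i)) {c : ℝ} (hc : 0 < c) :
    ∃ x : H, ‖x‖ = 1 ∧ ∀ i, ‖T i x‖ ^ 2 < c := by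
  by_contra! hn
  refine hT (isUnit_sum_of_bounded_below T hc fun x => ?_)
  rcases eq_or_ne x 0 with rfl | hx
  · simp
  have hx' : 0 < ‖x‖ := norm_pos_iff.2 hx
  obtain ⟨i, hi⟩ := hn (((‖x‖⁻¹ : ℝ) : ℂ) • x) (by
    rw [norm_smul, Complex.norm_real, norm_inv, norm_norm, inv_mul_cancel₀ hx'.ne'])
  rw [map_smul, norm_smul, Complex.norm_real, norm_inv, norm_norm, mul_pow, inv_pow,
    inv_mul_eq_div, le_div_iff₀ (by positivity)] at hi
  exact hi.trans (Finset.single_le_sum (f := fun i => ‖T i x‖ ^ 2)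
    (fun _ _ => by positivity) (Finset.mem_univ i))

theorem exists_unit_vectors_of_character {ι : Type*} [Fintype ι]
    {B : StarSubalgebra ℂ (H →L[ℂ] H)} [hB : IsClosed (B : Set (H →L[ℂ] H))]
    (Φ : B →ₐ[ℂ] ℂ) (T : ι → B) (hT : ∀ i, Φ (T i) = 0) :
    ∃ x : ℕ → H, (∀ k, ‖x k‖ = 1) ∧
      ∀ i, Tendsto (fun k => ‖(T i : H →L[ℂ] H) (x k)‖) atTop (nhds 0) := by
  have hn : ¬ IsUnit (∑ i, star (T i : H →L[ℂ] H) * T i) := by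
    intro h
    have h' : ((∑ i, star (T i) * T i : B) : H →L[ℂ] H) =
        ∑ i, star (T i : H →L[ℂ] H) * T i := by simp
    rw [← h', StarSubalgebra.coe_isUnit] at h
    have := h.map Φ
    simp [hT] at this
  choose x hx hxT using fun k : ℕ => exists_unit_vector_of_not_isUnit _ hn
    (c := (1 / ((k : ℝ) + 1)) ^ 2) (by positivity)
  refine ⟨x, hx, fun i => squeeze_zero (fun _ => norm_nonneg _) (fun k => ?_)
    tendsto_one_div_add_atTop_nhds_zero_nat⟩
  exact (lt_of_pow_lt_pow_left₀ 2 (by positivity) (hxT k i)).le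

end Characters

open ContinuousLinearMap Filter

/-- A multiplicative linear functional (character) on the unital C*-algebra generated by
operators `A₁, …, Aₙ` on a complex Hilbert space sending `Aᵢ` to `λᵢ` exists if and only
if there is a sequence of unit vectors `x_k` with `‖Aᵢ x_k − λᵢ x_k‖ → 0` and
`‖Aᵢ* x_k − conj(λᵢ) x_k‖ → 0` for each `i` (i.e. the column operator with entries
`Aᵢ − λᵢ` and `Aᵢ* − conj(λᵢ)` is not bounded below). -/
theorem stmt7 {H : Type*} [NormedAddCommGroup H] [InnerProductSpace ℂ H] [CompleteSpace H]
    (n : ℕ) (hn : 1 ≤ n) (A : Fin n → (H →L[ℂ] H)) (lam : Fin n → ℂ) :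
    (∃ Φ : ((StarAlgebra.adjoin ℂ (Set.range A)).topologicalClosure) →ₐ[ℂ] ℂ,
        (∀ T, Φ (star T) = (starRingEnd ℂ) (Φ T)) ∧
        (∀ i : Fin n, Φ ⟨A i,
          (StarAlgebra.adjoin ℂ (Set.range A)).le_topologicalClosure
            (StarAlgebra.subset_adjoin ℂ (Set.range A) (Set.mem_range_self i))⟩ = lam i)) ↔
    (∃ x : ℕ → H, (∀ k, ‖x k‖ = 1) ∧ ∀ i : Fin n,
        Tendsto (fun k => ‖A i (x k) - lam i • x k‖) atTop (nhds 0) ∧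
        Tendsto (fun k => ‖ContinuousLinearMap.adjoint (A i) (x k) -
          (starRingEnd ℂ) (lam i) • x k‖) atTop (nhds 0)) := by
  constructor
  · rintro ⟨Φ, hstar, hΦ⟩
    let B := (StarAlgebra.adjoin ℂ (Set.range A)).topologicalClosure
    let a : Fin n → B := fun i => ⟨A i,
      (StarAlgebra.adjoin ℂ (Set.range A)).le_topologicalClosure
        (StarAlgebra.subset_adjoin ℂ (Set.range A) (Set.mem_range_self i))⟩
    let T : Fin n → B := fun i => a i - algebraMap ℂ B (lam i)
    have hT (i) : Φ (T i) = 0 := by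
      rw [map_sub, AlgHom.commutes, hΦ]
      simp
    obtain ⟨x, hx, h⟩ := exists_unit_vectors_of_character
      (hB := (StarAlgebra.adjoin ℂ (Set.range A)).isClosed_topologicalClosure) Φ
      (Sum.elim T fun i => star (T i)) (by
        rintro (i | i)
        · exact hT i
        · simp [hstar, hT])
    refine ⟨x, hx, fun i => ⟨(h (.inl i)).congr fun k => ?_, (h (.inr i)).congr fun k => ?_⟩⟩
    · simp [T, a, Algebra.algebraMap_eq_smul_one]
    · simp [T, a, Algebra.algebraMap_eq_smul_one, star_eq_adjoint]
  · rintro ⟨x, hx, h⟩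
    let l : Ultrafilter ℕ := hyperfilter ℕ
    have hl : (l : Filter ℕ) ≤ atTop := Nat.hyperfilter_le_atTop
    have hA (i) : IsApproxEigen (l : Filter ℕ) x (A i) (lam i) :=
      IsApproxEigen.iff_norm.2 ((h i).1.mono_left hl)
    have hA' (i) : IsApproxEigen (l : Filter ℕ) x (star (A i)) (starRingEnd ℂ (lam i)) :=
      IsApproxEigen.iff_norm.2 ((h i).2.mono_left hl)
    have hle : (StarAlgebra.adjoin ℂ (Set.range A)).toSubalgebra ≤
        approxEigenSubalgebra (l : Filter ℕ) x := by
      rw [StarAlgebra.adjoin_toSubalgebra, Algebra.adjoin_le_iff]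
      rintro T (⟨i, rfl⟩ | ⟨i, hi⟩)
      · exact ⟨_, hA i⟩
      · exact ⟨_, by simpa [hi] using hA' i⟩
    obtain ⟨Φ, hstar, hΦ⟩ := exists_character_of_isApproxEigen l hx
      (StarAlgebra.adjoin ℂ (Set.range A)).topologicalClosure fun T hT =>
        Subalgebra.topologicalClosure_minimal hle (isClosed_approxEigenSubalgebra l hx) hT
    exact ⟨Φ, hstar, fun i => (hΦ _).unique hx (hA i)⟩
end

section
/- Let (a_n)_{n≥0} be a sequence of real numbers with 0 < a_n ≤ 1, and let T be the weighted unilateral shift on ℓ²(ℕ) defined by T e_n = a_n e_{n+1}, where (e_n) is the standard orthonormal basis. Let λ = ρ e^{iθ} ∈ ℂ with 0 ≤ ρ ≤ 1, and suppose that for every ε > 0 and every d ∈ ℕ there exists k ∈ ℕ such that |a_{k+i} − ρ| < ε for all 0 ≤ i ≤ d. Then there exists a sequence of unit vectors x_m ∈ ℓ²(ℕ) such that ‖T x_m − λ x_m‖ → 0 and ‖T* x_m − conj(λ) x_m‖ → 0 as m → ∞. -/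
open ContinuousLinearMap Filter

/-- The standard orthonormal basis vectors of `ℓ²(ℕ)`. -/
noncomputable def stdBasis (n : ℕ) : lp (fun _ : ℕ => ℂ) 2 := lp.single 2 n 1

lemma stdBasis_inner (n : ℕ) (f : lp (fun _ : ℕ => ℂ) 2) : inner ℂ (stdBasis n) f = f n := by
  simp [stdBasis, lp.inner_single_left]

lemma orthonormal_stdBasis : Orthonormal ℂ stdBasis := by
  classical
  rw [orthonormal_iff_ite]
  intro i j
  rw [stdBasis_inner]
  simp [stdBasis, Pi.single_apply]

lemma norm_stdBasis (n : ℕ) : ‖stdBasis n‖ = 1 := orthonormal_stdBasis.1 n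

lemma adjoint_weightedShift_stdBasis_succ {a : ℕ → ℝ}
    {T : lp (fun _ : ℕ => ℂ) 2 →L[ℂ] lp (fun _ : ℕ => ℂ) 2}
    (hT : ∀ n, T (stdBasis n) = (a n : ℂ) • stdBasis (n + 1)) (m : ℕ) :
    ContinuousLinearMap.adjoint T (stdBasis (m + 1)) = (a m : ℂ) • stdBasis m := by
  classical
  ext n
  rw [← stdBasis_inner, ← stdBasis_inner, ContinuousLinearMap.adjoint_inner_right, hT,
    inner_smul_left, inner_smul_right, orthonormal_iff_ite.1 orthonormal_stdBasis,
    orthonormal_iff_ite.1 orthonormal_stdBasis]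
  by_cases h : n = m <;> simp [h]

lemma Orthonormal.norm_sum_smul_sq {E : Type*} [NormedAddCommGroup E] [InnerProductSpace ℂ E]
    {ι : Type*} {v : ι → E} (hv : Orthonormal ℂ v) (c : ι → ℂ) (s : Finset ι)
    (hc : ∀ i ∈ s, ‖c i‖ = 1) : ‖∑ i ∈ s, c i • v i‖ ^ 2 = s.card := by
  have h := hv.inner_sum c c s
  rw [inner_self_eq_norm_sq_to_K] at h
  have h1 : ∑ i ∈ s, (starRingEnd ℂ) (c i) * c i = s.card := by
    rw [Finset.sum_congr rfl (g := fun _ => (1 : ℂ))]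
    · simp
    · intro i hi
      rw [Complex.conj_mul', hc i hi]
      simp
  rw [h1] at h
  exact Complex.ofReal_injective (by simpa using h)

lemma norm_sum_smul_sub_smul_sum_le {E : Type*} [NormedAddCommGroup E] [NormedSpace ℂ E]
    {D : ℕ} {c : ℕ → ℝ} {ρ : ℝ} (hρ0 : 0 ≤ ρ) (hρ1 : ρ ≤ 1) {u v : ℕ → E} {K : ℝ}
    (hc : ∀ j < D, |c j - ρ| ≤ 1 / D) (hu : ∀ j, ‖u j‖ ≤ 1)
    (huv : ‖∑ j ∈ Finset.range D, (u j - v j)‖ ≤ K) :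
    ‖∑ j ∈ Finset.range D, (c j : ℂ) • u j - (ρ : ℂ) • ∑ j ∈ Finset.range D, v j‖ ≤ 1 + K := by
  have key : ∑ j ∈ Finset.range D, (c j : ℂ) • u j - (ρ : ℂ) • ∑ j ∈ Finset.range D, v j =
      ∑ j ∈ Finset.range D, ((c j - ρ : ℝ) : ℂ) • u j +
        (ρ : ℂ) • ∑ j ∈ Finset.range D, (u j - v j) := by
    rw [Finset.smul_sum, Finset.smul_sum, ← Finset.sum_sub_distrib, ← Finset.sum_add_distrib]
    refine Finset.sum_congr rfl fun j _ => ?_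
    push_cast
    module
  rw [key]
  refine (norm_add_le _ _).trans (add_le_add ?_ ?_)
  · calc _ ≤ ∑ j ∈ Finset.range D, (1 / D : ℝ) := by
          refine norm_sum_le_of_le _ fun j hj => ?_
          rw [norm_smul, Complex.norm_real, Real.norm_eq_abs]
          exact (mul_le_of_le_one_right (abs_nonneg _) (hu j)).trans (hc j (Finset.mem_range.1 hj))
      _ ≤ 1 := by
          rw [Finset.sum_const, Finset.card_range, nsmul_eq_mul, mul_one_div]
          exact div_self_le_one _
  · rw [norm_smul, Complex.norm_real, Real.norm_eq_abs, abs_of_nonneg hρ0]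
    exact (mul_le_of_le_one_left (norm_nonneg _) hρ1).trans huv

/-- An unnormalized approximate joint eigenvector of the shift and its adjoint, with both defects
bounded independently of its norm `√D`. -/
lemma exists_norm_sq_eq_and_defect_le {a : ℕ → ℝ}
    {T : lp (fun _ : ℕ => ℂ) 2 →L[ℂ] lp (fun _ : ℕ => ℂ) 2}
    (hT : ∀ n, T (stdBasis n) = (a n : ℂ) • stdBasis (n + 1))
    {ρ : ℝ} (hρ0 : 0 ≤ ρ) (hρ1 : ρ ≤ 1) {w : ℂ} (hw : ‖w‖ = 1) {D k : ℕ}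
    (hk : ∀ i ≤ D, |a (k + i) - ρ| ≤ 1 / D) :
    ∃ y : lp (fun _ : ℕ => ℂ) 2, ‖y‖ ^ 2 = D ∧ ‖T y - ((ρ : ℂ) * w⁻¹) • y‖ ≤ 3 ∧
      ‖ContinuousLinearMap.adjoint T y - ((ρ : ℂ) * w) • y‖ ≤ 3 := by
  have hw0 : w ≠ 0 := by
    rintro rfl
    simp at hw
  have hunit (j n : ℕ) : ‖w ^ j • stdBasis n‖ = 1 := by
    rw [norm_smul, norm_pow, hw, one_pow, one_mul, norm_stdBasis]
  refine ⟨∑ j ∈ Finset.range D, w ^ j • stdBasis (k + 1 + j), ?_, ?_, ?_⟩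
  · have h := (orthonormal_stdBasis.comp (fun j : ℕ => k + 1 + j)
      (add_right_injective (k + 1))).norm_sum_smul_sq (fun j => w ^ j) (Finset.range D)
      (fun j _ => by rw [norm_pow, hw, one_pow])
    simpa using h
  · have h := norm_sum_smul_sub_smul_sum_le (D := D) (c := fun j => a (k + 1 + j)) hρ0 hρ1
      (u := fun j => w ^ j • stdBasis (k + 1 + (j + 1)))
      (v := fun j => w⁻¹ • w ^ j • stdBasis (k + 1 + j)) (K := 2)
      (fun j hj => by simpa only [add_assoc] using hk (1 + j) (by lia))
      (fun j => (hunit _ _).le) ?_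
    · refine (congrArg norm ?_).trans_le (h.trans_eq (by norm_num))
      rw [map_sum, ← Finset.smul_sum, mul_smul]
      congr 1
      refine Finset.sum_congr rfl fun j _ => ?_
      rw [map_smul, hT, smul_comm, add_assoc _ j 1]
    · have htel := Finset.sum_range_sub (fun j => w⁻¹ • w ^ j • stdBasis (k + 1 + j)) D
      have hshift (j : ℕ) : w⁻¹ • w ^ (j + 1) • stdBasis (k + 1 + (j + 1)) =
          w ^ j • stdBasis (k + 1 + (j + 1)) := by
        rw [smul_smul, pow_succ', inv_mul_cancel_left₀ hw0]
      simp only [hshift] at htel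
      rw [htel]
      refine (norm_sub_le _ _).trans ?_
      rw [norm_smul _ (w ^ D • _), norm_smul _ (w ^ 0 • _), hunit, hunit, norm_inv, hw]
      norm_num
  · have h := norm_sum_smul_sub_smul_sum_le (D := D) (c := fun j => a (k + j)) hρ0 hρ1
      (u := fun j => w ^ j • stdBasis (k + j))
      (v := fun j => w ^ (j + 1) • stdBasis (k + (j + 1))) (K := 2)
      (fun j hj => hk j hj.le) (fun j => (hunit _ _).le) ?_
    · refine (congrArg norm ?_).trans_le (h.trans_eq (by norm_num))
      rw [map_sum, mul_smul, Finset.smul_sum (r := w)]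
      congr 1
      · refine Finset.sum_congr rfl fun j _ => ?_
        rw [map_smul, add_right_comm, adjoint_weightedShift_stdBasis_succ hT, smul_comm]
      · congr 1
        refine Finset.sum_congr rfl fun j _ => ?_
        rw [smul_smul, pow_succ', add_assoc, add_comm 1 j]
    · rw [Finset.sum_range_sub' (fun j => w ^ j • stdBasis (k + j))]
      refine (norm_sub_le _ _).trans ?_
      rw [hunit, hunit]
      norm_num

/-- Let `T` be the weighted unilateral shift on `ℓ²(ℕ)` with weights `0 < a_n ≤ 1`,
and let `λ = ρ e^{iθ}` with `0 ≤ ρ ≤ 1`.  If for every `ε > 0` and `d ∈ ℕ` there is a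
`k` with `|a_{k+i} − ρ| < ε` for all `0 ≤ i ≤ d`, then there is a sequence of unit
vectors `x_m` with `‖T x_m − λ x_m‖ → 0` and `‖T* x_m − conj(λ) x_m‖ → 0`. -/
theorem stmt11 (a : ℕ → ℝ) (ha : ∀ n, 0 < a n ∧ a n ≤ 1)
    (T : lp (fun _ : ℕ => ℂ) 2 →L[ℂ] lp (fun _ : ℕ => ℂ) 2)
    (hT : ∀ n, T (stdBasis n) = (a n : ℂ) • stdBasis (n + 1))
    (ρ θ : ℝ) (hρ0 : 0 ≤ ρ) (hρ1 : ρ ≤ 1)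
    (lam : ℂ) (hlam : lam = (ρ : ℂ) * Complex.exp (θ * Complex.I))
    (happrox : ∀ ε > (0 : ℝ), ∀ d : ℕ, ∃ k : ℕ, ∀ i ≤ d, |a (k + i) - ρ| < ε) :
    ∃ x : ℕ → lp (fun _ : ℕ => ℂ) 2, (∀ m, ‖x m‖ = 1) ∧
      Tendsto (fun m => ‖T (x m) - lam • x m‖) atTop (nhds 0) ∧
      Tendsto (fun m => ‖ContinuousLinearMap.adjoint T (x m) -
        (starRingEnd ℂ) lam • x m‖) atTop (nhds 0) := by
  set w : ℂ := Complex.exp ((-θ : ℝ) * Complex.I) with hw_def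
  have hw : ‖w‖ = 1 := Complex.norm_exp_ofReal_mul_I _
  have hlam_inv : lam = (ρ : ℂ) * w⁻¹ := by
    rw [hlam, hw_def, ← Complex.exp_neg]
    simp
  have hlam_conj : (starRingEnd ℂ) lam = (ρ : ℂ) * w := by
    rw [hlam, hw_def, map_mul, Complex.conj_ofReal, ← Complex.exp_conj]
    simp
  choose k hk using fun m : ℕ =>
    happrox (1 / (m + 1 : ℕ)) (by positivity) (m + 1)
  choose y hy hTy hTy' using fun m : ℕ =>
    exists_norm_sq_eq_and_defect_le hT hρ0 hρ1 hw fun i hi => (hk m i hi).le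
  have hy' (m : ℕ) : ‖y m‖ = √((m : ℝ) + 1) := by
    rw [← Real.sqrt_sq (norm_nonneg (y m)), hy, Nat.cast_add_one]
  have hpos (m : ℕ) : 0 < √((m : ℝ) + 1) := by positivity
  have hlim : Tendsto (fun m : ℕ => (√((m : ℝ) + 1))⁻¹ * 3) atTop (nhds 0) := by
    rw [← zero_mul (3 : ℝ)]
    exact ((Real.tendsto_sqrt_atTop.comp
      (tendsto_natCast_atTop_atTop.atTop_add tendsto_const_nhds)).inv_tendsto_atTop).mul_const 3
  have hdefect (S : lp (fun _ : ℕ => ℂ) 2 →L[ℂ] lp (fun _ : ℕ => ℂ) 2) (μ : ℂ)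
      (hS : ∀ m, ‖S (y m) - μ • y m‖ ≤ 3) :
      Tendsto (fun m : ℕ => ‖S (((√((m : ℝ) + 1))⁻¹ : ℂ) • y m) -
        μ • ((√((m : ℝ) + 1))⁻¹ : ℂ) • y m‖) atTop (nhds 0) := by
    refine squeeze_zero (fun _ => norm_nonneg _) (fun m => ?_) hlim
    rw [map_smul, smul_comm μ, ← smul_sub, norm_smul, norm_inv, Complex.norm_real,
      Real.norm_of_nonneg (hpos m).le]
    exact mul_le_mul_of_nonneg_left (hS m) (inv_nonneg.2 (hpos m).le)
  refine ⟨fun m => ((√((m : ℝ) + 1))⁻¹ : ℂ) • y m, fun m => ?_,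
    hdefect T lam fun m => hlam_inv ▸ hTy m, hdefect _ _ fun m => hlam_conj ▸ hTy' m⟩
  rw [norm_smul, hy', norm_inv, Complex.norm_real, Real.norm_of_nonneg (hpos m).le,
    inv_mul_cancel₀ (hpos m).ne']
end
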